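/- With the notation of the context, writing τ := τ^E_{m,n}, 𝔅_{−1} := Σ_{i=1}^{2r} ∂/∂c_i and 𝔅_0 := Σ_{i=1}^{2r} c_i ∂/∂c_i, the following two identities hold as identities of functions of all parameters: (1) 𝔅_{−1} τ = Σ_{i≥2} ( Σ_{l=1}^q i s_i^{(l)} ∂τ/∂s_{i−1}^{(l)} + Σ_{l=1}^p i t_i^{(l)} ∂τ/∂t_{i−1}^{(l)} ) + Σ_{l=1}^q (1−2α_l) ∂τ/∂s_1^{(l)} + 2 Σ_{l=1}^p β_l ∂τ/∂t_1^{(l)} + ( Σ_{l=1}^p n_l t_1^{(l)} − Σ_{l=1}^q m_l s_1^{(l)} ) τ + ( Σ_{l=1}^q a_l m_l + Σ_{l=1}^p b_l n_l ) τ; (2) 𝔅_0 τ = Σ_{i≥1} ( Σ_{l=1}^q i s_i^{(l)} ∂τ/∂s_i^{(l)} + Σ_{l=1}^p i t_i^{(l)} ∂τ/∂t_i^{(l)} ) − Σ_{l=1}^q a_l ∂τ/∂s_1^{(l)} + Σ_{l=1}^p b_l ∂τ/∂t_1^{(l)} + Σ_{l=1}^q (1−2α_l) ∂τ/∂s_2^{(l)}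 + 2 Σ_{l=1}^p β_l ∂τ/∂t_2^{(l)} + (1/2)( Σ_{l=1}^q m_l² + Σ_{l=1}^p n_l² ) τ. (Since the time sequences are finitely supported, the infinite sums have only finitely many nonzero terms at each point.) -/

import Mathlib

open MeasureTheory Finset

/-- Partial sum `M_k = Σ_{j<k} m_j` of the block sizes. -/
def Msum {q : ℕ} (m : Fin q → ℕ) (k : ℕ) : ℕ :=
  ∑ j ∈ Finset.univ.filter (fun j : Fin q => (j : ℕ) < k), m j

theorem Msum_add_lt {q : ℕ} (m : Fin q → ℕ) (r : Fin q) (i : Fin (m r)) :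
    Msum m (r : ℕ) + (i : ℕ) < ∑ j, m j := by
  have h2 : m r ≤ ∑ j ∈ Finset.univ.filter (fun j : Fin q => ¬ (j : ℕ) < (r : ℕ)), m j :=
    Finset.single_le_sum (fun j _ => Nat.zero_le (m j)) (by simp)
  have h3 : Msum m (r : ℕ) +
      ∑ j ∈ Finset.univ.filter (fun j : Fin q => ¬ (j : ℕ) < (r : ℕ)), m j = ∑ j, m j :=
    Finset.sum_filter_add_sum_filter_not _ _ _
  have h4 := i.isLt
  omega

/-- The index `M_{r−1} + i` of the `i`-th element of the `r`-th block (`0`-based). -/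
def blkIdx {q : ℕ} (m : Fin q → ℕ) (r : Fin q) (i : Fin (m r)) : Fin (∑ j, m j) :=
  ⟨Msum m (r : ℕ) + (i : ℕ), Msum_add_lt m r i⟩

theorem Msum_block_le {q : ℕ} (m : Fin q → ℕ) {u u' : Fin q} (h : u < u') :
    Msum m (u : ℕ) + m u ≤ Msum m (u' : ℕ) := by
  have hsub : insert u (Finset.univ.filter (fun j : Fin q => (j : ℕ) < (u : ℕ)))
      ⊆ Finset.univ.filter (fun j : Fin q => (j : ℕ) < (u' : ℕ)) := by
    intro j hj
    simp only [Finset.mem_insert, Finset.mem_filter, Finset.mem_univ, true_and] at hj ⊢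
    have huu' : (u : ℕ) < (u' : ℕ) := h
    rcases hj with rfl | hj
    · exact huu'
    · omega
  have hle := Finset.sum_le_sum_of_subset (f := m) hsub
  rw [Finset.sum_insert (by simp)] at hle
  unfold Msum
  omega

theorem blkIdx_injective {q : ℕ} (m : Fin q → ℕ) :
    Function.Injective (fun x : Σ r : Fin q, Fin (m r) => blkIdx m x.1 x.2) := by
  rintro ⟨r, i⟩ ⟨r', i'⟩ h
  have hval : Msum m (r : ℕ) + (i : ℕ) = Msum m (r' : ℕ) + (i' : ℕ) := congrArg Fin.val h
  rcases lt_trichotomy r r' with hlt | heq | hgt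
  · exact absurd hval (by have h1 := Msum_block_le m hlt; have h2 := i.isLt; omega)
  · subst heq
    have : i = i' := Fin.ext (by omega)
    rw [this]
  · exact absurd hval (by have h1 := Msum_block_le m hgt; have h2 := i'.isLt; omega)

/-- The canonical (order-preserving) equivalence between `Σ r, Fin (m r)` and `Fin (Σ m)`,
sending `(r, i)` to `M_{r−1} + i`. -/
noncomputable def blkEquiv {q : ℕ} (m : Fin q → ℕ) : (Σ r : Fin q, Fin (m r)) ≃ Fin (∑ j, m j) :=
  Equiv.ofBijective (fun x => blkIdx m x.1 x.2)
    ((Fintype.bijective_iff_injective_and_card _).mpr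
      ⟨blkIdx_injective m, by simp [Fintype.card_sigma]⟩)

/-- The deformed tau function `τ^E_{m,n}(t,s;α,β;a,b)`: the determinant of the `N×N` moment
matrix composed of `p·q` blocks, the `(k,l)` block of size `m_k × n_l` having entries
`∫_E x^{i+j} exp((a_k+b_l)x + (α_k+β_l)x² − Σ_{ν≥1} s_ν^{(k)} x^ν + Σ_{ν≥1} t_ν^{(l)} x^ν − x²/2) dx`
(defined to be `0` when the total block sizes do not match). -/
noncomputable def tauGen {q p : ℕ} (m : Fin q → ℕ) (n : Fin p → ℕ) (E : Set ℝ)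
    (a : Fin q → ℝ) (b : Fin p → ℝ) (al : Fin q → ℝ) (be : Fin p → ℝ)
    (s : Fin q → ℕ → ℝ) (t : Fin p → ℕ → ℝ) : ℝ :=
  if h : ∑ l, n l = ∑ k, m k then
    Matrix.det (Matrix.of fun ri cj : Fin (∑ k, m k) =>
      ∫ x in E,
        x ^ (((((blkEquiv m).symm ri).2 : ℕ)) + ((((blkEquiv n).symm (finCongr h.symm cj)).2 : ℕ))) *
          Real.exp ((a ((blkEquiv m).symm ri).1 + b ((blkEquiv n).symm (finCongr h.symm cj)).1) * x
            + (al ((blkEquiv m).symm ri).1 + be ((blkEquiv n).symm (finCongr h.symm cj)).1) * x ^ 2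
            - (∑ᶠ ν ∈ Set.Ici (1 : ℕ), s ((blkEquiv m).symm ri).1 ν * x ^ ν)
            + (∑ᶠ ν ∈ Set.Ici (1 : ℕ), t ((blkEquiv n).symm (finCongr h.symm cj)).1 ν * x ^ ν)
            - x ^ 2 / 2))
  else 0

/-- The set `E = ⋃_{i=1}^r [c_{2i−1}, c_{2i}]`. -/
def Eset {r : ℕ} (c : Fin (2 * r) → ℝ) : Set ℝ :=
  ⋃ i : Fin r, Set.Icc (c ⟨2 * (i : ℕ), by have := i.isLt; omega⟩)
    (c ⟨2 * (i : ℕ) + 1, by have := i.isLt; omega⟩)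

/-- The full set of parameters of the deformed problem: the starting/ending points `a, b`,
the auxiliary parameters `α, β`, the time variables `s, t`, and the endpoints `c` of `E`. -/
structure Par (q p r : ℕ) where
  a : Fin q → ℝ
  b : Fin p → ℝ
  al : Fin q → ℝ
  be : Fin p → ℝ
  s : Fin q → ℕ → ℝ
  t : Fin p → ℕ → ℝ
  c : Fin (2 * r) → ℝ

/-- `∂/∂a_k`. -/
noncomputable def dAp {q p r : ℕ} (k : Fin q) (f : Par q p r → ℝ) : Par q p r → ℝ :=
  fun P => deriv (fun h => f { P with a := Function.update P.a k h }) (P.a k)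

/-- `∂/∂b_l`. -/
noncomputable def dBp {q p r : ℕ} (l : Fin p) (f : Par q p r → ℝ) : Par q p r → ℝ :=
  fun P => deriv (fun h => f { P with b := Function.update P.b l h }) (P.b l)

/-- `∂/∂α_k`. -/
noncomputable def dAlp {q p r : ℕ} (k : Fin q) (f : Par q p r → ℝ) : Par q p r → ℝ :=
  fun P => deriv (fun h => f { P with al := Function.update P.al k h }) (P.al k)

/-- `∂/∂β_l`. -/
noncomputable def dBep {q p r : ℕ} (l : Fin p) (f : Par q p r → ℝ) : Par q p r → ℝ :=
  fun P => deriv (fun h => f { P with be := Function.update P.be l h }) (P.be l)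

/-- `∂/∂s_ν^{(k)}`. -/
noncomputable def dSp {q p r : ℕ} (k : Fin q) (ν : ℕ) (f : Par q p r → ℝ) : Par q p r → ℝ :=
  fun P => deriv
    (fun h => f { P with s := Function.update P.s k (Function.update (P.s k) ν h) }) (P.s k ν)

/-- `∂/∂t_ν^{(l)}`. -/
noncomputable def dTp {q p r : ℕ} (l : Fin p) (ν : ℕ) (f : Par q p r → ℝ) : Par q p r → ℝ :=
  fun P => deriv
    (fun h => f { P with t := Function.update P.t l (Function.update (P.t l) ν h) }) (P.t l ν)

/-- `∂/∂c_i`. -/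
noncomputable def dCp {q p r : ℕ} (i : Fin (2 * r)) (f : Par q p r → ℝ) : Par q p r → ℝ :=
  fun P => deriv (fun h => f { P with c := Function.update P.c i h }) (P.c i)

/-- The tau function `τ^E_{m,n}` as a function of all the parameters, with
`E = ⋃_{i=1}^r [c_{2i−1}, c_{2i}]`. -/
noncomputable def tauPar {q p r : ℕ} (m : Fin q → ℕ) (n : Fin p → ℕ) : Par q p r → ℝ :=
  fun P => tauGen m n (Eset P.c) P.a P.b P.al P.be P.s P.t

/-- Jacobi's formula along a differentiable curve of matrices. -/
theorem hasDerivAt_matrix_det {ι : Type*} [Fintype ι] [DecidableEq ι]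
    {A : ℝ → Matrix ι ι ℝ} {A' : Matrix ι ι ℝ} {h₀ : ℝ}
    (hA : ∀ i j, HasDerivAt (fun h => A h i j) (A' i j) h₀) :
    HasDerivAt (fun h => (A h).det) ((A h₀).adjugate * A').trace h₀ := by
  let f : ContinuousMultilinearMap ℝ (fun _ : ι => ι → ℝ) ℝ :=
    { (Matrix.detRowAlternating (n := ι) (R := ℝ)).toMultilinearMap with
      cont := Continuous.matrix_det continuous_id }
  have hrow : ∀ i, HasFDerivAt (fun h => A h i) (ContinuousLinearMap.toSpanSingleton ℝ (A' i)) h₀ :=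
    fun i => (hasDerivAt_pi.2 (hA i)).hasFDerivAt
  have hdet := (HasFDerivAt.multilinear_comp (f := f) hrow).hasDerivAt
  convert! hdet using 1
  rw [_root_.sum_apply, Matrix.trace_mul_comm]
  refine Finset.sum_congr rfl fun i _ => ?_
  have h1 : ((A h₀).updateRow i (A' i)).det = (A' * (A h₀).adjugate) i i := by
    rw [← Matrix.cramer_transpose_apply, Matrix.cramer_eq_adjugate_mulVec,
      ← Matrix.adjugate_transpose, Matrix.mulVec_transpose]
    rfl
  simp only [Matrix.diag_apply, ← h1, ContinuousLinearMap.comp_apply,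
    ContinuousLinearMap.toSpanSingleton_apply, one_smul]
  rfl

theorem trace_adjugate_mul_row_map {ι : Type*} [Fintype ι] [DecidableEq ι]
    (A : Matrix ι ι ℝ) (f : ι → ι) (w : ι → ℝ) :
    (A.adjugate * Matrix.of fun r c => w r * A (f r) c).trace
      = (∑ r, if f r = r then w r else 0) * A.det := by
  have h1 : (Matrix.of fun r c => w r * A (f r) c)
      = (Matrix.of fun r r' => if f r = r' then w r else 0) * A := by
    ext r c
    simp [Matrix.mul_apply]
  rw [h1, ← Matrix.mul_assoc, Matrix.trace_mul_comm, ← Matrix.mul_assoc, Matrix.mul_adjugate]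
  rw [Matrix.smul_mul, Matrix.one_mul, Matrix.trace_smul, smul_eq_mul, mul_comm]
  rfl

theorem trace_adjugate_mul_col_map {ι : Type*} [Fintype ι] [DecidableEq ι]
    (A : Matrix ι ι ℝ) (f : ι → ι) (w : ι → ℝ) :
    (A.adjugate * Matrix.of fun r c => w c * A r (f c)).trace
      = (∑ c, if f c = c then w c else 0) * A.det := by
  have h1 : (Matrix.of fun r c => w c * A r (f c))
      = A * (Matrix.of fun c' c => if f c = c' then w c else 0) := by
    ext r c
    simp [Matrix.mul_apply, mul_comm]
  rw [h1, ← Matrix.mul_assoc, Matrix.adjugate_mul]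
  rw [Matrix.smul_mul, Matrix.one_mul, Matrix.trace_smul, smul_eq_mul, mul_comm]
  rfl

theorem hasDerivAt_setIntegral_mul_exp {K : Set ℝ} (hK : IsCompact K) {g φ u : ℝ → ℝ}
    (hg : Continuous g) (hφ : Continuous φ) (hu : Continuous u) (h₀ : ℝ) :
    HasDerivAt (fun h => ∫ x in K, g x * Real.exp (φ x + (h - h₀) * u x))
      (∫ x in K, g x * u x * Real.exp (φ x)) h₀ := by
  have hint : ∀ f : ℝ → ℝ, Continuous f → Integrable f (volume.restrict K) :=
    fun f hf => hf.continuousOn.integrableOn_compact hK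
  have key := (hasDerivAt_integral_of_dominated_loc_of_deriv_le (μ := volume.restrict K)
    (F := fun h x => g x * Real.exp (φ x + (h - h₀) * u x))
    (F' := fun h x => g x * u x * Real.exp (φ x + (h - h₀) * u x))
    (bound := fun x => |g x * u x| * Real.exp (φ x + |u x|))
    (x₀ := h₀) (Metric.ball_mem_nhds h₀ one_pos)
    (Filter.Eventually.of_forall fun h => (hint _ (by fun_prop)).aestronglyMeasurable)
    (hint _ (by fun_prop)) (hint _ (by fun_prop)).aestronglyMeasurable
    (Filter.Eventually.of_forall fun x h hh => ?_) (hint _ (by fun_prop))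
    (Filter.Eventually.of_forall fun x h _ => ?_)).2
  · simpa using key
  · rw [norm_mul, Real.norm_eq_abs, Real.norm_eq_abs, Real.abs_exp]
    have hh' : |h - h₀| ≤ 1 := by
      rw [Metric.mem_ball, Real.dist_eq] at hh
      exact hh.le
    have : (h - h₀) * u x ≤ |u x| := by
      refine (le_abs_self _).trans ?_
      rw [abs_mul]
      exact mul_le_of_le_one_left (abs_nonneg _) hh'
    gcongr
  · have h1 : HasDerivAt (fun h => φ x + (h - h₀) * u x) (u x) h := by
      simpa using (((hasDerivAt_id h).sub_const h₀).mul_const (u x)).const_add (φ x)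
    convert! (h1.exp.const_mul (g x)) using 1
    ring

/-- The boundary orientation of the endpoints of a union of intervals: `-1` at left endpoints,
`1` at right endpoints. -/
def endpointSign (i : ℕ) : ℝ := if Even i then -1 else 1

theorem sum_endpointSign_mul (r : ℕ) (f : Fin (2 * r) → ℝ) :
    ∑ i : Fin (2 * r), endpointSign i * f i
      = ∑ j : Fin r, (f ⟨2 * (j : ℕ) + 1, by have := j.isLt; omega⟩
          - f ⟨2 * (j : ℕ), by have := j.isLt; omega⟩) := by
  let g : ℕ → ℝ := fun i => if h : i < 2 * r then f ⟨i, h⟩ else 0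
  have hg : ∀ (i : ℕ) (h : i < 2 * r), f ⟨i, h⟩ = g i := fun i h => by simp [g, h]
  have hpair : ∀ k, ∑ i ∈ range (2 * k), endpointSign i * g i
      = ∑ j ∈ range k, (g (2 * j + 1) - g (2 * j)) := by
    intro k
    induction k with
    | zero => simp
    | succ k ih =>
      rw [show 2 * (k + 1) = 2 * k + 1 + 1 by ring, sum_range_succ, sum_range_succ, ih,
        sum_range_succ]
      simp [endpointSign]
      ring
  have h1 : ∀ i : Fin (2 * r), endpointSign i * f i = (fun i : ℕ => endpointSign i * g i) i :=
    fun i => by simp only [← hg i i.isLt]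
  simp only [h1]
  simp only [hg]
  rw [Fin.sum_univ_eq_sum_range (fun i : ℕ => endpointSign i * g i),
    Fin.sum_univ_eq_sum_range (fun j : ℕ => g (2 * j + 1) - g (2 * j)), hpair]

theorem exists_bound_of_finite_support {κ : Type*} [Finite κ] {f : κ → ℕ → ℝ}
    (hf : ∀ i, (Function.support (f i)).Finite) : ∃ K, ∀ i ν, K ≤ ν → f i ν = 0 := by
  obtain ⟨K, hK⟩ := (Set.finite_iUnion hf).bddAbove
  refine ⟨K + 1, fun i ν hν => ?_⟩
  by_contra h
  have : ν ≤ K := hK (Set.mem_iUnion.2 ⟨i, h⟩)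
  omega

theorem finsum_mem_Ici_eq_sum_Ico {f : ℕ → ℝ} {K : ℕ} (hf : ∀ ν, K ≤ ν → f ν = 0) (j : ℕ) :
    ∑ᶠ ν ∈ Set.Ici j, f ν = ∑ ν ∈ Ico j K, f ν := by
  refine finsum_mem_eq_sum_of_subset _ (fun ν hν => ?_) (fun ν hν => ?_)
  · simp only [coe_Ico, Set.mem_Ico]
    exact ⟨hν.1, not_le.1 fun h => hν.2 (hf ν h)⟩
  · exact (Finset.mem_Ico.1 hν).1

theorem finsum_update_mul_pow {s : ℕ → ℝ} (hs : (Function.support s).Finite) {ν : ℕ} (hν : 1 ≤ ν)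
    (h x : ℝ) :
    ∑ᶠ μ ∈ Set.Ici (1 : ℕ), Function.update s ν h μ * x ^ μ
      = (∑ᶠ μ ∈ Set.Ici (1 : ℕ), s μ * x ^ μ) + (h - s ν) * x ^ ν := by
  obtain ⟨K, hK⟩ := exists_bound_of_finite_support (κ := Unit) (f := fun _ => s) fun _ => hs
  have hK' := hK ()
  rw [finsum_mem_Ici_eq_sum_Ico (K := max K (ν + 1)), finsum_mem_Ici_eq_sum_Ico (K := max K (ν + 1))]
  · have hmem : ν ∈ Ico 1 (max K (ν + 1)) := by simp; omega
    have h1 : ∀ μ, Function.update s ν h μ * x ^ μ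
        = s μ * x ^ μ + if ν = μ then (h - s ν) * x ^ ν else 0 := by
      intro μ
      by_cases hμ : ν = μ
      · subst hμ
        simp
        ring
      · simp [hμ, Ne.symm hμ]
    simp only [h1, sum_add_distrib, sum_ite_eq, hmem, if_true]
  · intro μ hμ
    simp [hK' μ (le_trans (le_max_left _ _) hμ)]
  · intro μ hμ
    have h1 := le_trans (le_max_right _ _) hμ
    have h2 : μ ≠ ν := by omega
    simp [h2, hK' μ (le_trans (le_max_left _ _) hμ)]

theorem Eset_isCompact {r : ℕ} (c : Fin (2 * r) → ℝ) : IsCompact (Eset c) :=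
  isCompact_iUnion fun _ => isCompact_Icc

theorem setIntegral_Eset {r : ℕ} {c : Fin (2 * r) → ℝ} (hc : StrictMono c) {f : ℝ → ℝ}
    (hf : Continuous f) :
    ∫ x in Eset c, f x = ∑ i : Fin (2 * r), endpointSign i * ∫ x in (0 : ℝ)..c i, f x := by
  have hii : ∀ u v : ℝ, IntervalIntegrable f volume u v := fun u v => hf.intervalIntegrable u v
  rw [sum_endpointSign_mul r fun i => ∫ x in (0 : ℝ)..c i, f x, Eset,
    integral_iUnion_fintype (fun _ => measurableSet_Icc)]
  · refine Finset.sum_congr rfl fun j _ => ?_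
    rw [integral_Icc_eq_integral_Ioc, ← intervalIntegral.integral_of_le,
      intervalIntegral.integral_interval_sub_left (hii _ _) (hii _ _)]
    exact hc.monotone (by simp)
  · have hlt : ∀ j k : Fin r, j < k →
        Disjoint (Set.Icc (c ⟨2 * (j : ℕ), by have := j.isLt; omega⟩)
          (c ⟨2 * (j : ℕ) + 1, by have := j.isLt; omega⟩))
        (Set.Icc (c ⟨2 * (k : ℕ), by have := k.isLt; omega⟩)
          (c ⟨2 * (k : ℕ) + 1, by have := k.isLt; omega⟩)) := by
      intro j k hjk
      rw [Set.disjoint_left]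
      intro x hx hx'
      have : c ⟨2 * (j : ℕ) + 1, by have := j.isLt; omega⟩
          < c ⟨2 * (k : ℕ), by have := k.isLt; omega⟩ :=
        hc (by rw [Fin.lt_def] at hjk ⊢; simp only; omega)
      linarith [hx.2, hx'.1]
    intro j k hjk
    rcases lt_or_gt_of_ne hjk with h | h
    · exact hlt j k h
    · exact (hlt k j h).symm
  · exact fun j => hf.continuousOn.integrableOn_compact isCompact_Icc

theorem setIntegral_Eset_deriv {r : ℕ} {c : Fin (2 * r) → ℝ} (hc : StrictMono c) {f f' : ℝ → ℝ}
    (hf : ∀ x, HasDerivAt f (f' x) x) (hf' : Continuous f') :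
    ∫ x in Eset c, f' x = ∑ i : Fin (2 * r), endpointSign i * f (c i) := by
  have h1 : ∀ u : ℝ, ∫ x in (0 : ℝ)..u, f' x = f u - f 0 := fun u =>
    intervalIntegral.integral_eq_sub_of_hasDerivAt (fun x _ => hf x) (hf'.intervalIntegrable _ _)
  rw [setIntegral_Eset hc hf', sum_endpointSign_mul r fun i => ∫ x in (0 : ℝ)..c i, f' x,
    sum_endpointSign_mul r fun i => f (c i)]
  simp only [h1]
  exact Finset.sum_congr rfl fun j _ => by ring

theorem eventually_strictMono_update {κ : Type*} [Finite κ] [Preorder κ] [DecidableEq κ] {c : κ → ℝ}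
    (hc : StrictMono c) (i : κ) : ∀ᶠ h in nhds (c i), StrictMono (Function.update c i h) := by
  have h1 : ∀ j k : κ, j < k →
      ∀ᶠ h in nhds (c i), Function.update c i h j < Function.update c i h k := by
    intro j k hjk
    have hcont : ∀ j, Continuous fun h => Function.update c i h j := fun j =>
      (continuous_apply j).comp ((continuous_const (y := c)).update i continuous_id)
    refine (hcont j).continuousAt.eventually_lt (hcont k).continuousAt ?_
    simpa using hc hjk
  have h2 : ∀ᶠ h in nhds (c i), ∀ j k, j < k →
      Function.update c i h j < Function.update c i h k := by
    simp only [Filter.eventually_all]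
    exact h1
  exact h2.mono fun h hh j k hjk => hh j k hjk

theorem hasDerivAt_setIntegral_Eset_update {r : ℕ} {c : Fin (2 * r) → ℝ} (hc : StrictMono c)
    {f : ℝ → ℝ} (hf : Continuous f) (i : Fin (2 * r)) :
    HasDerivAt (fun h => ∫ x in Eset (Function.update c i h), f x)
      (endpointSign i * f (c i)) (c i) := by
  have h1 : HasDerivAt
      (fun h => ∑ j : Fin (2 * r), endpointSign j * ∫ x in (0 : ℝ)..Function.update c i h j, f x)
      (∑ j, if i = j then endpointSign i * f (c i) else 0) (c i) := by
    refine HasDerivAt.fun_sum fun j _ => ?_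
    by_cases hj : i = j
    · subst hj
      simp only [Function.update_self, if_true]
      exact (hf.integral_hasStrictDerivAt 0 (c i)).hasDerivAt.const_mul _
    · simp only [hj, if_false, Function.update_of_ne (Ne.symm hj)]
      exact hasDerivAt_const _ _
  rw [Finset.sum_ite_eq] at h1
  simp only [mem_univ, if_true] at h1
  refine h1.congr_of_eventuallyEq ?_
  filter_upwards [eventually_strictMono_update hc i] with h hh
  exact setIntegral_Eset hh hf

/-- The exponent of the weight in the `(k,l)` block. -/
noncomputable def weightExponent {q p r : ℕ} (P : Par q p r) (k : Fin q) (l : Fin p) (x : ℝ) : ℝ :=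
  (P.a k + P.b l) * x + (P.al k + P.be l) * x ^ 2
    - (∑ᶠ ν ∈ Set.Ici (1 : ℕ), P.s k ν * x ^ ν) + (∑ᶠ ν ∈ Set.Ici (1 : ℕ), P.t l ν * x ^ ν)
    - x ^ 2 / 2

/-- The integrand `x ^ d * exp (…)` of the moments of the `(k,l)` block. -/
noncomputable def momentDensity {q p r : ℕ} (P : Par q p r) (k : Fin q) (l : Fin p) (d : ℕ)
    (x : ℝ) : ℝ :=
  x ^ d * Real.exp (weightExponent P k l x)

/-- The `d`-th moment of the `(k,l)` block over `E`. -/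
noncomputable def moment {q p r : ℕ} (P : Par q p r) (k : Fin q) (l : Fin p) (d : ℕ) : ℝ :=
  ∫ x in Eset P.c, momentDensity P k l d x

section

variable {q p r : ℕ} {P : Par q p r}

theorem weightExponent_eq_sum {K : ℕ} (hs : ∀ k ν, K ≤ ν → P.s k ν = 0)
    (ht : ∀ l ν, K ≤ ν → P.t l ν = 0) (k : Fin q) (l : Fin p) (x : ℝ) :
    weightExponent P k l x = (P.a k + P.b l) * x + (P.al k + P.be l) * x ^ 2
      - (∑ ν ∈ Ico 1 K, P.s k ν * x ^ ν) + (∑ ν ∈ Ico 1 K, P.t l ν * x ^ ν) - x ^ 2 / 2 := by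
  rw [weightExponent, finsum_mem_Ici_eq_sum_Ico (K := K) fun ν hν => by simp [hs k ν hν],
    finsum_mem_Ici_eq_sum_Ico (K := K) fun ν hν => by simp [ht l ν hν]]

theorem continuous_weightExponent (hs : ∀ i, (Function.support (P.s i)).Finite)
    (ht : ∀ i, (Function.support (P.t i)).Finite) (k : Fin q) (l : Fin p) :
    Continuous (weightExponent P k l) := by
  obtain ⟨K₁, h1⟩ := exists_bound_of_finite_support hs
  obtain ⟨K₂, h2⟩ := exists_bound_of_finite_support ht
  have h : weightExponent P k l = _ := funext <| weightExponent_eq_sum (K := max K₁ K₂)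
    (fun k ν hν => h1 k ν (le_trans (le_max_left _ _) hν))
    (fun k ν hν => h2 k ν (le_trans (le_max_right _ _) hν)) k l
  rw [h]
  fun_prop

theorem continuous_momentDensity (hs : ∀ i, (Function.support (P.s i)).Finite)
    (ht : ∀ i, (Function.support (P.t i)).Finite) (k : Fin q) (l : Fin p) (d : ℕ) :
    Continuous (momentDensity P k l d) := by
  have := continuous_weightExponent hs ht k l
  unfold momentDensity
  fun_prop

theorem hasDerivAt_moment_s (hs : ∀ i, (Function.support (P.s i)).Finite)
    (ht : ∀ i, (Function.support (P.t i)).Finite) (k₀ : Fin q) {ν : ℕ} (hν : 1 ≤ ν)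
    (k : Fin q) (l : Fin p) (d : ℕ) :
    HasDerivAt (fun h => moment
        { P with s := Function.update P.s k₀ (Function.update (P.s k₀) ν h) } k l d)
      (if k = k₀ then -moment P k l (d + ν) else 0) (P.s k₀ ν) := by
  by_cases hk : k = k₀
  · subst hk
    have key := hasDerivAt_setIntegral_mul_exp (Eset_isCompact P.c) (continuous_pow d)
      (continuous_weightExponent hs ht k l) (u := fun x => -x ^ ν)
      (continuous_pow ν).neg (P.s k ν)
    convert! key using 1
    · funext h
      simp only [moment, momentDensity, weightExponent, Function.update_self,
        finsum_update_mul_pow (hs k) hν]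
      congr! 4 with x
      ring
    · rw [if_pos rfl, moment, ← integral_neg]
      congr! 2 with x
      simp only [momentDensity]
      ring
  · simp only [if_neg hk, moment, momentDensity, weightExponent, Function.update_of_ne hk]
    exact hasDerivAt_const _ _

theorem hasDerivAt_moment_t (hs : ∀ i, (Function.support (P.s i)).Finite)
    (ht : ∀ i, (Function.support (P.t i)).Finite) (l₀ : Fin p) {ν : ℕ} (hν : 1 ≤ ν)
    (k : Fin q) (l : Fin p) (d : ℕ) :
    HasDerivAt (fun h => moment
        { P with t := Function.update P.t l₀ (Function.update (P.t l₀) ν h) } k l d)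
      (if l = l₀ then moment P k l (d + ν) else 0) (P.t l₀ ν) := by
  by_cases hl : l = l₀
  · subst hl
    have key := hasDerivAt_setIntegral_mul_exp (Eset_isCompact P.c) (continuous_pow d)
      (continuous_weightExponent hs ht k l) (continuous_pow ν) (P.t l ν)
    convert! key using 1
    · funext h
      simp only [moment, momentDensity, weightExponent, Function.update_self,
        finsum_update_mul_pow (ht l) hν]
      congr! 4 with x
      ring
    · rw [if_pos rfl, moment]
      congr! 2 with x
      simp only [momentDensity]
      ring
  · simp only [if_neg hl, moment, momentDensity, weightExponent, Function.update_of_ne hl]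
    exact hasDerivAt_const _ _

theorem hasDerivAt_moment_c (hc : StrictMono P.c) (hs : ∀ i, (Function.support (P.s i)).Finite)
    (ht : ∀ i, (Function.support (P.t i)).Finite) (i : Fin (2 * r))
    (k : Fin q) (l : Fin p) (d : ℕ) :
    HasDerivAt (fun h => moment { P with c := Function.update P.c i h } k l d)
      (endpointSign i * momentDensity P k l d (P.c i)) (P.c i) :=
  hasDerivAt_setIntegral_Eset_update hc (continuous_momentDensity hs ht k l d) i

/-- The boundary terms of the moments, by integrating the derivative of the density over `E`. -/
theorem sum_endpointSign_mul_momentDensity (hc : StrictMono P.c) {K : ℕ}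
    (hs : ∀ k ν, K ≤ ν → P.s k ν = 0) (ht : ∀ l ν, K ≤ ν → P.t l ν = 0)
    (k : Fin q) (l : Fin p) (d : ℕ) :
    ∑ i : Fin (2 * r), endpointSign i * momentDensity P k l d (P.c i)
      = d * moment P k l (d - 1) + (P.a k + P.b l) * moment P k l d
        + (2 * (P.al k + P.be l) - 1) * moment P k l (d + 1)
        + ∑ ν ∈ Ico 1 K, ν * (P.t l ν - P.s k ν) * moment P k l (d + (ν - 1)) := by
  have hsupp : ∀ f : ℕ → ℝ, (∀ ν, K ≤ ν → f ν = 0) → (Function.support f).Finite := fun f hf =>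
    (Set.finite_Iio K).subset fun ν hν => not_le.1 fun h => hν (hf ν h)
  have hcont : ∀ d, Continuous (momentDensity P k l d) := fun d =>
    continuous_momentDensity (fun i => hsupp _ (hs i)) (fun i => hsupp _ (ht i)) k l d
  have hint : ∀ (d : ℕ) (w : ℝ),
      IntegrableOn (fun x => w * momentDensity P k l d x) (Eset P.c) := fun d w =>
    ((hcont d).const_mul w).continuousOn.integrableOn_compact (Eset_isCompact P.c)
  have hw : ∀ x, HasDerivAt (weightExponent P k l) (P.a k + P.b l
      + (2 * (P.al k + P.be l) - 1) * x
      + ∑ ν ∈ Ico 1 K, ν * (P.t l ν - P.s k ν) * x ^ (ν - 1)) x := by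
    intro x
    have hsum : ∀ f : ℕ → ℝ, HasDerivAt (fun x : ℝ => ∑ ν ∈ Ico 1 K, f ν * x ^ ν)
        (∑ ν ∈ Ico 1 K, f ν * (ν * x ^ (ν - 1))) x := fun f =>
      HasDerivAt.fun_sum fun ν _ => (hasDerivAt_pow ν x).const_mul (f ν)
    rw [funext (weightExponent_eq_sum hs ht k l)]
    convert! (((((hasDerivAt_id x).const_mul (P.a k + P.b l)).add
      ((hasDerivAt_pow 2 x).const_mul (P.al k + P.be l))).sub (hsum (P.s k))).add
      (hsum (P.t l))).sub ((hasDerivAt_pow 2 x).div_const 2) using 1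
    have h1 : ∑ ν ∈ Ico 1 K, (ν : ℝ) * (P.t l ν - P.s k ν) * x ^ (ν - 1)
        = ∑ ν ∈ Ico 1 K, P.t l ν * (ν * x ^ (ν - 1))
          - ∑ ν ∈ Ico 1 K, P.s k ν * (ν * x ^ (ν - 1)) := by
      rw [← sum_sub_distrib]
      exact sum_congr rfl fun ν _ => by ring
    rw [h1]
    norm_num
    ring
  have hderiv : ∀ x, HasDerivAt (momentDensity P k l d)
      (d * momentDensity P k l (d - 1) x + (P.a k + P.b l) * momentDensity P k l d x
        + (2 * (P.al k + P.be l) - 1) * momentDensity P k l (d + 1) x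
        + ∑ ν ∈ Ico 1 K, ν * (P.t l ν - P.s k ν) * momentDensity P k l (d + (ν - 1)) x) x := by
    intro x
    have h1 : ∑ ν ∈ Ico 1 K, ν * (P.t l ν - P.s k ν) * momentDensity P k l (d + (ν - 1)) x
        = x ^ d * Real.exp (weightExponent P k l x)
          * ∑ ν ∈ Ico 1 K, ν * (P.t l ν - P.s k ν) * x ^ (ν - 1) := by
      rw [mul_sum]
      exact sum_congr rfl fun ν _ => by rw [momentDensity, pow_add]; ring
    rw [h1]
    convert! (hasDerivAt_pow d x).mul (hw x).exp using 1
    simp only [momentDensity]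
    ring
  rw [← setIntegral_Eset_deriv hc hderiv (by fun_prop), integral_add, integral_add, integral_add,
    integral_finsetSum]
  · simp only [integral_const_mul, moment]
  · exact fun ν _ => hint _ _
  · exact hint _ _
  · exact hint _ _
  · exact (hint _ _).add (hint _ _)
  · exact hint _ _
  · exact ((hint _ _).add (hint _ _)).add (hint _ _)
  · exact integrable_finsetSum _ fun ν _ => hint _ _

end

section

variable {ι : Type*} {q : ℕ} {m : Fin q → ℕ}

/-- The index of the preceding element in the same block (the first element is fixed). -/
def predInBlock (e : ι ≃ Σ k : Fin q, Fin (m k)) (x : ι) : ι :=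
  e.symm ⟨(e x).1, ⟨((e x).2 : ℕ) - 1, by have := (e x).2.isLt; omega⟩⟩

theorem apply_predInBlock_fst (e : ι ≃ Σ k : Fin q, Fin (m k)) (x : ι) :
    (e (predInBlock e x)).1 = (e x).1 := by
  rw [predInBlock, Equiv.apply_symm_apply]

theorem apply_predInBlock_snd (e : ι ≃ Σ k : Fin q, Fin (m k)) (x : ι) :
    ((e (predInBlock e x)).2 : ℕ) = ((e x).2 : ℕ) - 1 := by
  rw [predInBlock, Equiv.apply_symm_apply]

theorem sum_ite_predInBlock_eq_self [Fintype ι] [DecidableEq ι]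
    (e : ι ≃ Σ k : Fin q, Fin (m k)) :
    (∑ x, if predInBlock e x = x then (((e x).2 : ℕ) : ℝ) else 0) = 0 := by
  refine Finset.sum_eq_zero fun x _ => ?_
  split_ifs with h
  · have h1 := apply_predInBlock_snd e x
    rw [h] at h1
    have h2 : ((e x).2 : ℕ) = 0 := by omega
    simp [h2]
  · rfl

theorem sum_block_const [Fintype ι] (e : ι ≃ Σ k : Fin q, Fin (m k)) (w : Fin q → ℝ) :
    ∑ x, w (e x).1 = ∑ k, (m k : ℝ) * w k := by
  rw [Equiv.sum_comp e fun y => w y.1, Fintype.sum_sigma]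
  simp

theorem sum_block_index_add_half [Fintype ι] (e : ι ≃ Σ k : Fin q, Fin (m k)) :
    ∑ x, ((((e x).2 : ℕ) : ℝ) + 1 / 2) = 1 / 2 * ∑ k, (m k : ℝ) ^ 2 := by
  rw [Equiv.sum_comp e fun y => (((y.2 : ℕ) : ℝ) + 1 / 2), Fintype.sum_sigma, mul_sum]
  refine Finset.sum_congr rfl fun k _ => ?_
  rw [Fin.sum_univ_eq_sum_range fun i : ℕ => (i : ℝ) + 1 / 2]
  induction m k with
  | zero => simp
  | succ j ih =>
    rw [sum_range_succ, ih]
    push_cast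
    ring

end

/-- The matrix composed of Hankel blocks `(M k l (i + j))`. -/
def blockHankel {ι : Type*} {q p : ℕ} {m : Fin q → ℕ} {n : Fin p → ℕ}
    (eR : ι ≃ Σ k : Fin q, Fin (m k)) (eC : ι ≃ Σ l : Fin p, Fin (n l))
    (M : Fin q → Fin p → ℕ → ℝ) : Matrix ι ι ℝ :=
  Matrix.of fun x y => M (eR x).1 (eC y).1 (((eR x).2 : ℕ) + ((eC y).2 : ℕ))

/-- The splitting into column blocks of the common index set of rows and columns. -/
noncomputable def colEquiv {q p : ℕ} (m : Fin q → ℕ) (n : Fin p → ℕ)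
    (hsum : ∑ l, n l = ∑ k, m k) : Fin (∑ k, m k) ≃ Σ l : Fin p, Fin (n l) :=
  (finCongr hsum.symm).trans (blkEquiv n).symm

/-- The differential of the determinant at `A`. -/
noncomputable def detDifferential {ι : Type*} [Fintype ι] [DecidableEq ι] (A : Matrix ι ι ℝ) :
    Matrix ι ι ℝ →ₗ[ℝ] ℝ :=
  Matrix.traceLinearMap ι ℝ ℝ ∘ₗ LinearMap.mulLeft ℝ A.adjugate

theorem detDifferential_apply {ι : Type*} [Fintype ι] [DecidableEq ι] (A X : Matrix ι ι ℝ) :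
    detDifferential A X = (A.adjugate * X).trace := rfl

section

variable {q p r : ℕ} (m : Fin q → ℕ) (n : Fin p → ℕ) (hsum : ∑ l, n l = ∑ k, m k)

/-- The moment matrix of the tau function. -/
noncomputable def momentMatrix (P : Par q p r) : Matrix (Fin (∑ k, m k)) (Fin (∑ k, m k)) ℝ :=
  blockHankel (blkEquiv m).symm (colEquiv m n hsum) (moment P)

theorem tauPar_eq_det (P : Par q p r) : tauPar m n P = (momentMatrix m n hsum P).det := by
  rw [tauPar, tauGen, dif_pos hsum]
  rfl

theorem deriv_tauPar {Q : ℝ → Par q p r} {P : Par q p r} {M' : Fin q → Fin p → ℕ → ℝ} {h₀ : ℝ}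
    (hQ : Q h₀ = P) (hM : ∀ k l d, HasDerivAt (fun h => moment (Q h) k l d) (M' k l d) h₀) :
    deriv (fun h => tauPar m n (Q h)) h₀
      = detDifferential (momentMatrix m n hsum P)
          (blockHankel (blkEquiv m).symm (colEquiv m n hsum) M') := by
  simp only [tauPar_eq_det m n hsum, ← hQ]
  exact (hasDerivAt_matrix_det fun _ _ => hM _ _ _).deriv

end

/-- The explicit Virasoro constraints for `k = −1` and `k = 0` displayed in Section 4, as
identities of functions of all the parameters (the time sequences being finitely supported,
the infinite sums have only finitely many nonzero terms). -/
theorem virasoro_constraints_k_neg_one_and_zero (q p r : ℕ) (hq : 1 ≤ q) (hp : 1 ≤ p)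
    (m : Fin q → ℕ) (n : Fin p → ℕ) (hm1 : ∀ i, 1 ≤ m i) (hn1 : ∀ l, 1 ≤ n l)
    (hsum : ∑ l, n l = ∑ i, m i)
    (P : Par q p r) (hc : StrictMono P.c)
    (hs : ∀ i, (Function.support (P.s i)).Finite)
    (ht : ∀ i, (Function.support (P.t i)).Finite) :
    ((∑ i : Fin (2 * r), dCp i (tauPar m n) P) =
      (∑ᶠ i ∈ Set.Ici (2 : ℕ),
          ((∑ l : Fin q, (i : ℝ) * P.s l i * dSp l (i - 1) (tauPar m n) P)
            + ∑ l : Fin p, (i : ℝ) * P.t l i * dTp l (i - 1) (tauPar m n) P))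
        + (∑ l : Fin q, (1 - 2 * P.al l) * dSp l 1 (tauPar m n) P)
        + 2 * (∑ l : Fin p, P.be l * dTp l 1 (tauPar m n) P)
        + ((∑ l : Fin p, ((n l : ℕ) : ℝ) * P.t l 1) - (∑ l : Fin q, ((m l : ℕ) : ℝ) * P.s l 1))
            * tauPar m n P
        + ((∑ l : Fin q, P.a l * ((m l : ℕ) : ℝ)) + (∑ l : Fin p, P.b l * ((n l : ℕ) : ℝ)))
            * tauPar m n P) ∧
    ((∑ i : Fin (2 * r), P.c i * dCp i (tauPar m n) P) =
      (∑ᶠ i ∈ Set.Ici (1 : ℕ),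
          ((∑ l : Fin q, (i : ℝ) * P.s l i * dSp l i (tauPar m n) P)
            + ∑ l : Fin p, (i : ℝ) * P.t l i * dTp l i (tauPar m n) P))
        - (∑ l : Fin q, P.a l * dSp l 1 (tauPar m n) P)
        + (∑ l : Fin p, P.b l * dTp l 1 (tauPar m n) P)
        + (∑ l : Fin q, (1 - 2 * P.al l) * dSp l 2 (tauPar m n) P)
        + 2 * (∑ l : Fin p, P.be l * dTp l 2 (tauPar m n) P)
        + (1 / 2 : ℝ) * ((∑ l : Fin q, ((m l : ℕ) : ℝ) ^ 2) + (∑ l : Fin p, ((n l : ℕ) : ℝ) ^ 2))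
            * tauPar m n P) := by
  have hS : ∀ k ν, 1 ≤ ν → dSp k ν (tauPar m n) P = detDifferential (momentMatrix m n hsum P)
      (blockHankel (blkEquiv m).symm (colEquiv m n hsum)
        fun k' l d => if k' = k then -moment P k' l (d + ν) else 0) := fun k ν hν =>
    deriv_tauPar m n hsum (by simp) fun k' l d => hasDerivAt_moment_s hs ht k hν k' l d
  have hT : ∀ l ν, 1 ≤ ν → dTp l ν (tauPar m n) P = detDifferential (momentMatrix m n hsum P)
      (blockHankel (blkEquiv m).symm (colEquiv m n hsum)
        fun k l' d => if l' = l then moment P k l' (d + ν) else 0) := fun l ν hν =>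
    deriv_tauPar m n hsum (by simp) fun k l' d => hasDerivAt_moment_t hs ht l hν k l' d
  have hC : ∀ i, dCp i (tauPar m n) P = detDifferential (momentMatrix m n hsum P)
      (blockHankel (blkEquiv m).symm (colEquiv m n hsum)
        fun k l d => endpointSign i * momentDensity P k l d (P.c i)) := fun i =>
    deriv_tauPar m n hsum (by simp) fun k l d => hasDerivAt_moment_c hc hs ht i k l d
  obtain ⟨K₁, hK₁⟩ := exists_bound_of_finite_support hs
  obtain ⟨K₂, hK₂⟩ := exists_bound_of_finite_support ht
  obtain ⟨K, hK, hsK, htK⟩ : ∃ K, 2 ≤ K ∧ (∀ k ν, K ≤ ν → P.s k ν = 0) ∧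
      ∀ l ν, K ≤ ν → P.t l ν = 0 :=
    ⟨K₁ + K₂ + 2, by omega, fun k ν hν => hK₁ k ν (by omega), fun l ν hν => hK₂ l ν (by omega)⟩
  have hftc := sum_endpointSign_mul_momentDensity hc hsK htK
  have hrow := trace_adjugate_mul_row_map (momentMatrix m n hsum P)
  have hcol := trace_adjugate_mul_col_map (momentMatrix m n hsum P)
  simp only [← detDifferential_apply, ← tauPar_eq_det] at hrow hcol
  rw [finsum_mem_Ici_eq_sum_Ico (K := K) (fun i hi => by simp [hsK _ i hi, htK _ i hi]),
    finsum_mem_Ici_eq_sum_Ico (K := K) (fun i hi => by simp [hsK _ i hi, htK _ i hi])]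
  have hentry : ∀ x y, momentMatrix m n hsum P x y = moment P ((blkEquiv m).symm x).1
      (colEquiv m n hsum y).1 ((((blkEquiv m).symm x).2 : ℕ) + ((colEquiv m n hsum y).2 : ℕ)) :=
    fun _ _ => rfl
  set eR := (blkEquiv m).symm
  set eC := colEquiv m n hsum
  set L := detDifferential (momentMatrix m n hsum P)
  constructor
  · have hmat : ∑ i : Fin (2 * r), blockHankel eR eC
          (fun k l d => endpointSign i * momentDensity P k l d (P.c i))
        = ∑ i ∈ Ico 2 K,
            ((∑ l, ((i : ℝ) * P.s l i) • blockHankel eR eC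
                fun k' l' d => if k' = l then -moment P k' l' (d + (i - 1)) else 0)
              + ∑ l, ((i : ℝ) * P.t l i) • blockHankel eR eC
                fun k' l' d => if l' = l then moment P k' l' (d + (i - 1)) else 0)
          + (∑ l, (1 - 2 * P.al l) • blockHankel eR eC
              fun k' l' d => if k' = l then -moment P k' l' (d + 1) else 0)
          + (2 : ℝ) • (∑ l, P.be l • blockHankel eR eC
              fun k' l' d => if l' = l then moment P k' l' (d + 1) else 0)
          + (Matrix.of fun x y => (((eR x).2 : ℕ) : ℝ)
              * momentMatrix m n hsum P (predInBlock eR x) y)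
          + (Matrix.of fun x y => (((eC y).2 : ℕ) : ℝ)
              * momentMatrix m n hsum P x (predInBlock eC y))
          + (Matrix.of fun x y => (P.a (eR x).1 - P.s (eR x).1 1)
              * momentMatrix m n hsum P (id x) y)
          + (Matrix.of fun x y => (P.b (eC y).1 + P.t (eC y).1 1)
              * momentMatrix m n hsum P x (id y)) := by
      ext x y
      simp only [Matrix.add_apply, Matrix.sum_apply, Matrix.smul_apply, Matrix.of_apply,
        blockHankel, smul_eq_mul, mul_ite, mul_zero, sum_ite_eq, mem_univ, if_true, id, hentry,
        apply_predInBlock_fst, apply_predInBlock_snd, hftc]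
      generalize (eR x).1 = k, ((eR x).2 : ℕ) = i, (eC y).1 = l, ((eC y).2 : ℕ) = j
      rw [sum_eq_sum_Ico_succ_bot (by omega)]
      have h1 : ∑ ν ∈ Ico (1 + 1) K, (ν : ℝ) * (P.t l ν - P.s k ν) * moment P k l (i + j + (ν - 1))
          = ∑ ν ∈ Ico 2 K, ((ν : ℝ) * P.s k ν * -moment P k l (i + j + (ν - 1))
            + (ν : ℝ) * P.t l ν * moment P k l (i + j + (ν - 1))) :=
        sum_congr rfl fun ν _ => by ring
      have h2 : ((i + j : ℕ) : ℝ) * moment P k l (i + j - 1)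
          = i * moment P k l (i - 1 + j) + j * moment P k l (i + (j - 1)) := by
        rcases Nat.eq_zero_or_pos i with rfl | hi <;> rcases Nat.eq_zero_or_pos j with rfl | hj
        · simp
        · simp
        · simp
        · rw [show i - 1 + j = i + j - 1 by omega, show i + (j - 1) = i + j - 1 by omega]
          push_cast
          ring
      rw [h1, h2]
      simp only [Nat.sub_self, add_zero, Nat.cast_one]
      ring
    have key := congrArg L hmat
    simp only [map_add, map_sum, map_smul, smul_eq_mul, hrow, hcol,
      sum_ite_predInBlock_eq_self, id, if_true, zero_mul, add_zero] at key
    rw [sum_block_const eR fun k => P.a k - P.s k 1,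
      sum_block_const eC fun l => P.b l + P.t l 1] at key
    have h1 : ∀ i ∈ Ico 2 K,
        (∑ l, (i : ℝ) * P.s l i * dSp l (i - 1) (tauPar m n) P)
          + (∑ l, (i : ℝ) * P.t l i * dTp l (i - 1) (tauPar m n) P)
          = (∑ l, (i : ℝ) * P.s l i * L (blockHankel eR eC
                fun k' l' d => if k' = l then -moment P k' l' (d + (i - 1)) else 0))
            + ∑ l, (i : ℝ) * P.t l i * L (blockHankel eR eC
                fun k' l' d => if l' = l then moment P k' l' (d + (i - 1)) else 0) := by
      intro i hi
      have hi' : 1 ≤ i - 1 := by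
        have := (Finset.mem_Ico.1 hi).1
        omega
      simp only [hS _ _ hi', hT _ _ hi']
    rw [sum_congr rfl h1]
    simp only [hC, hS _ 1 le_rfl, hT _ 1 le_rfl]
    rw [key]
    simp only [mul_sub, mul_add, sum_add_distrib, sum_sub_distrib, mul_comm (P.a _),
      mul_comm (P.b _)]
    ring
  · have hmat : ∑ i : Fin (2 * r), P.c i • blockHankel eR eC
          (fun k l d => endpointSign i * momentDensity P k l d (P.c i))
        = ∑ i ∈ Ico 1 K,
            ((∑ l, ((i : ℝ) * P.s l i) • blockHankel eR eC
                fun k' l' d => if k' = l then -moment P k' l' (d + i) else 0)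
              + ∑ l, ((i : ℝ) * P.t l i) • blockHankel eR eC
                fun k' l' d => if l' = l then moment P k' l' (d + i) else 0)
          - (∑ l, P.a l • blockHankel eR eC
              fun k' l' d => if k' = l then -moment P k' l' (d + 1) else 0)
          + (∑ l, P.b l • blockHankel eR eC
              fun k' l' d => if l' = l then moment P k' l' (d + 1) else 0)
          + (∑ l, (1 - 2 * P.al l) • blockHankel eR eC
              fun k' l' d => if k' = l then -moment P k' l' (d + 2) else 0)
          + (2 : ℝ) • (∑ l, P.be l • blockHankel eR eC
              fun k' l' d => if l' = l then moment P k' l' (d + 2) else 0)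
          + (Matrix.of fun x y => ((((eR x).2 : ℕ) : ℝ) + 1 / 2)
              * momentMatrix m n hsum P (id x) y)
          + (Matrix.of fun x y => ((((eC y).2 : ℕ) : ℝ) + 1 / 2)
              * momentMatrix m n hsum P x (id y)) := by
      ext x y
      have hmul : ∀ i k l d, P.c i * (endpointSign i * momentDensity P k l d (P.c i))
          = endpointSign i * momentDensity P k l (d + 1) (P.c i) := by
        intro i k l d
        simp only [momentDensity]
        ring
      simp only [Matrix.add_apply, Matrix.sub_apply, Matrix.sum_apply, Matrix.smul_apply,
        Matrix.of_apply, blockHankel, smul_eq_mul, mul_ite, mul_zero, sum_ite_eq, mem_univ,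
        if_true, id, hentry, hmul, hftc]
      generalize (eR x).1 = k, ((eR x).2 : ℕ) = i, (eC y).1 = l, ((eC y).2 : ℕ) = j
      have h1 : ∑ ν ∈ Ico 1 K,
            (ν : ℝ) * (P.t l ν - P.s k ν) * moment P k l (i + j + 1 + (ν - 1))
          = ∑ ν ∈ Ico 1 K, ((ν : ℝ) * P.s k ν * -moment P k l (i + j + ν)
            + (ν : ℝ) * P.t l ν * moment P k l (i + j + ν)) := by
        refine sum_congr rfl fun ν hν => ?_
        have := (Finset.mem_Ico.1 hν).1
        rw [show i + j + 1 + (ν - 1) = i + j + ν by omega]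
        ring
      rw [h1, Nat.add_sub_cancel, show i + j + 1 + 1 = i + j + 2 by ring]
      push_cast
      ring
    have key := congrArg L hmat
    simp only [map_add, map_sub, map_sum, map_smul, smul_eq_mul, hrow, hcol, id, if_true] at key
    rw [sum_block_index_add_half, sum_block_index_add_half] at key
    have h1 : ∀ i ∈ Ico 1 K,
        (∑ l, (i : ℝ) * P.s l i * dSp l i (tauPar m n) P)
          + (∑ l, (i : ℝ) * P.t l i * dTp l i (tauPar m n) P)
          = (∑ l, (i : ℝ) * P.s l i * L (blockHankel eR eC
                fun k' l' d => if k' = l then -moment P k' l' (d + i) else 0))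
            + ∑ l, (i : ℝ) * P.t l i * L (blockHankel eR eC
                fun k' l' d => if l' = l then moment P k' l' (d + i) else 0) := by
      intro i hi
      have hi' : 1 ≤ i := (Finset.mem_Ico.1 hi).1
      simp only [hS _ _ hi', hT _ _ hi']
    rw [sum_congr rfl h1]
    simp only [hC, hS _ 1 le_rfl, hT _ 1 le_rfl, hS _ 2 one_le_two, hT _ 2 one_le_two]
    rw [key]
    ring
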